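/- For every μ ∈ ℂ \ {0,1} and every character (a₀;a₁,a₂,a₃,a₄) with aᵢ > 0, 2a₀ = a₁+a₂+a₃+a₄, and 2aᵢ < a₁+a₂+a₃+a₄ for each i, the quadruple S_μ = (ℂ²; span(e₁), span(e₂), span(e₁+μe₂), span(e₁+e₂)) can be unitarized with this character: there exists an inner product on ℂ² such that the orthogonal projections Pᵢ onto the four lines satisfy a₁P₁ + a₂P₂ + a₃P₃ + a₄P₄ = a₀I. -/

import Mathlib

/-- The system of subspaces `Vs` of the complex vector space `V` can be
unitarized with character `(a₀; a)`: there is a (positive definite hermitian)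
inner product `B` on `V` such that the `B`-orthogonal projections `P i` onto
the subspaces `Vs i` satisfy `∑ i, a i • P i = a₀ • I`. -/
def Unitarizable {V : Type*} [AddCommGroup V] [Module ℂ V] {n : ℕ}
    (Vs : Fin n → Submodule ℂ V) (a₀ : ℝ) (a : Fin n → ℝ) : Prop :=
  ∃ (B : V → V → ℂ) (P : Fin n → V →ₗ[ℂ] V),
    (∀ x y z, B (x + y) z = B x z + B y z) ∧
    (∀ (c : ℂ) (x y : V), B (c • x) y = (starRingEnd ℂ) c * B x y) ∧
    (∀ x y, B x y = (starRingEnd ℂ) (B y x)) ∧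
    (∀ x, x ≠ 0 → 0 < (B x x).re) ∧
    (∀ i, LinearMap.range (P i) = Vs i) ∧
    (∀ i, P i ∘ₗ P i = P i) ∧
    (∀ i x y, B (P i x) y = B x (P i y)) ∧
    (∑ i, (a i : ℂ) • P i) = (a₀ : ℂ) • LinearMap.id

/-- squared euclidean distance from `w` to `z`, plus the height `s`. -/
noncomputable def hgt (z : ℝ × ℝ) (x : ℝ × ℝ × ℝ) : ℝ :=
  (x.1 - z.1) ^ 2 + (x.2.1 - z.2) ^ 2 + x.2.2

/-- the functional to be minimized -/
noncomputable def Fun3 (a b c d : ℝ) (z₁ z₂ z₃ : ℝ × ℝ) (x : ℝ × ℝ × ℝ) : ℝ :=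
  a * Real.log (hgt z₁ x) + b * Real.log (hgt z₂ x) + c * Real.log (hgt z₃ x)
    - d * Real.log x.2.2

theorem hgt_ge (z : ℝ × ℝ) (x : ℝ × ℝ × ℝ) : x.2.2 ≤ hgt z x := by
  unfold hgt; nlinarith [sq_nonneg (x.1 - z.1), sq_nonneg (x.2.1 - z.2)]

theorem hgt_sep (z y : ℝ × ℝ) (x : ℝ × ℝ × ℝ) (hx : 0 < x.2.2) (c : ℝ)
    (hc : 4 * c ≤ (z.1 - y.1) ^ 2 + (z.2 - y.2) ^ 2) (h : hgt z x < c) : c ≤ hgt y x := by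
  unfold hgt at *
  nlinarith [sq_nonneg (x.1 - z.1 + (x.1 - y.1)), sq_nonneg (x.2.1 - z.2 + (x.2.1 - y.2))]

/-- two factors bounded below forces a lower bound on the height -/
theorem low_aux (a b c d L k e f g h s : ℝ) (_ha : 0 < a) (hb : 0 < b) (hc : 0 < c)
    (he : 0 < e) (had : a + e ≤ d) (hbc : b + c ≤ 2 * d) (hk : 0 < k) (hk1 : k ≤ 1)
    (hs : 0 < s) (hs1 : s ≤ 1)
    (hf : s ≤ f) (hg : k ≤ g) (hh : k ≤ h)
    (hL : a * Real.log f + b * Real.log g + c * Real.log h - d * Real.log s ≤ L) :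
    Real.exp ((2 * d * Real.log k - L) / e) ≤ s := by
  have h1 := Real.log_le_log hs hf
  have h2 := Real.log_le_log hk hg
  have h3 := Real.log_le_log hk hh
  have h4 := Real.log_nonpos hs.le hs1
  have h5 := Real.log_nonpos hk.le hk1
  rw [← Real.le_log_iff_exp_le hs, div_le_iff₀ he]
  nlinarith [mul_le_mul_of_nonneg_left h1 _ha.le, mul_le_mul_of_nonneg_left h2 hb.le,
    mul_le_mul_of_nonneg_left h3 hc.le, mul_nonneg (sub_nonneg.2 had) (neg_nonneg.2 h4),
    mul_nonneg (sub_nonneg.2 hbc) (neg_nonneg.2 h5)]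

theorem low_bound (a b c d L : ℝ) (z₁ z₂ z₃ : ℝ × ℝ) (ha : 0 < a) (hb : 0 < b) (hc : 0 < c)
    (had : a < d) (hbd : b < d) (hcd : c < d)
    (h12 : z₁ ≠ z₂) (h13 : z₁ ≠ z₃) (h23 : z₂ ≠ z₃) :
    ∃ δ > 0, ∀ x : ℝ × ℝ × ℝ, 0 < x.2.2 → Fun3 a b c d z₁ z₂ z₃ x ≤ L → δ ≤ x.2.2 := by
  have key : ∀ z z' : ℝ × ℝ, z ≠ z' → 0 < (z.1 - z'.1) ^ 2 + (z.2 - z'.2) ^ 2 := by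
    intro z z' h
    by_contra hn
    apply h
    ext
    · nlinarith [sq_nonneg (z.1 - z'.1), sq_nonneg (z.2 - z'.2)]
    · nlinarith [sq_nonneg (z.1 - z'.1), sq_nonneg (z.2 - z'.2)]
  obtain ⟨k, hk, hk'⟩ : ∃ k : ℝ, 0 < k ∧ k ≤ 1 ∧
      4 * k ≤ (z₁.1 - z₂.1) ^ 2 + (z₁.2 - z₂.2) ^ 2 ∧
      4 * k ≤ (z₁.1 - z₃.1) ^ 2 + (z₁.2 - z₃.2) ^ 2 ∧
      4 * k ≤ (z₂.1 - z₃.1) ^ 2 + (z₂.2 - z₃.2) ^ 2 := by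
    have p := key _ _ h12
    have q := key _ _ h13
    have r := key _ _ h23
    generalize (z₁.1 - z₂.1) ^ 2 + (z₁.2 - z₂.2) ^ 2 = P at *
    generalize (z₁.1 - z₃.1) ^ 2 + (z₁.2 - z₃.2) ^ 2 = Q at *
    generalize (z₂.1 - z₃.1) ^ 2 + (z₂.2 - z₃.2) ^ 2 = R at *
    refine ⟨min 1 (min (P / 4) (min (Q / 4) (R / 4))), by positivity, min_le_left _ _, ?_, ?_, ?_⟩
    · have : min 1 (min (P / 4) (min (Q / 4) (R / 4))) ≤ P / 4 := by simp
      linarith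
    · have : min 1 (min (P / 4) (min (Q / 4) (R / 4))) ≤ Q / 4 := by simp
      linarith
    · have : min 1 (min (P / 4) (min (Q / 4) (R / 4))) ≤ R / 4 := by simp
      linarith
  obtain ⟨hk1, k12, k13, k23⟩ := hk'
  obtain ⟨e, he, e1, e2, e3⟩ : ∃ e : ℝ, 0 < e ∧ a + e ≤ d ∧ b + e ≤ d ∧ c + e ≤ d := by
    refine ⟨min (d - a) (min (d - b) (d - c)), ?_, ?_, ?_, ?_⟩
    · simp [had, hbd, hcd]
    · have : min (d - a) (min (d - b) (d - c)) ≤ d - a := by simp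
      linarith
    · have : min (d - a) (min (d - b) (d - c)) ≤ d - b := by simp
      linarith
    · have : min (d - a) (min (d - b) (d - c)) ≤ d - c := by simp
      linarith
  refine ⟨min 1 (Real.exp ((2 * d * Real.log k - L) / e)), by positivity, ?_⟩
  intro x hx hL
  rcases le_total 1 x.2.2 with h1 | h1
  · exact (min_le_left _ _).trans h1
  refine (min_le_right _ _).trans ?_
  unfold Fun3 at hL
  by_cases c1 : hgt z₁ x < k
  · exact low_aux a b c d L k e _ _ _ _ ha hb hc he e1 (by linarith) hk hk1 hx h1
      (hgt_ge z₁ x) (hgt_sep _ _ _ hx _ k12 c1) (hgt_sep _ _ _ hx _ k13 c1) hL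
  by_cases c2 : hgt z₂ x < k
  · exact low_aux b a c d L k e _ _ _ _ hb ha hc he e2 (by linarith) hk hk1 hx h1
      (hgt_ge z₂ x) (not_lt.1 c1) (hgt_sep _ _ _ hx _ k23 c2) (by linarith)
  · exact low_aux c a b d L k e _ _ _ _ hc ha hb he e3 (by linarith) hk hk1 hx h1
      (hgt_ge z₃ x) (not_lt.1 c1) (not_lt.1 c2) (by linarith)

theorem up_bound (a b c d L : ℝ) (z₁ z₂ z₃ : ℝ × ℝ) (ha : 0 < a) (hb : 0 < b) (hc : 0 < c)
    (hd : 0 < d) (hs : d < a + b + c) :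
    ∃ R : ℝ, ∀ x : ℝ × ℝ × ℝ, 0 < x.2.2 → Fun3 a b c d z₁ z₂ z₃ x ≤ L →
      x.1 ^ 2 + x.2.1 ^ 2 + x.2.2 ≤ R := by
  set M : ℝ := (z₁.1 ^ 2 + z₁.2 ^ 2) + (z₂.1 ^ 2 + z₂.2 ^ 2) + (z₃.1 ^ 2 + z₃.2 ^ 2) with hM
  refine ⟨max (4 * M) (Real.exp ((L + (a + b + c) * Real.log 4) / (a + b + c - d))), ?_⟩
  intro x hx hL
  rcases le_total (x.1 ^ 2 + x.2.1 ^ 2 + x.2.2) (4 * M) with h | h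
  · exact h.trans (le_max_left _ _)
  refine le_trans ?_ (le_max_right _ _)
  set R := x.1 ^ 2 + x.2.1 ^ 2 + x.2.2 with hR
  have hR0 : 0 < R := by positivity
  have hxR : x.2.2 ≤ R := by nlinarith [sq_nonneg x.1, sq_nonneg x.2.1]
  have key : ∀ z : ℝ × ℝ, z.1 ^ 2 + z.2 ^ 2 ≤ M → Real.log R - Real.log 4 ≤ Real.log (hgt z x) := by
    intro z hz
    rw [← Real.log_div hR0.ne' (by norm_num)]
    apply Real.log_le_log (by positivity)
    unfold hgt
    nlinarith [sq_nonneg (x.1 - 2 * z.1), sq_nonneg (x.2.1 - 2 * z.2)]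
  have k1 := key z₁ (by rw [hM]; nlinarith [sq_nonneg z₂.1, sq_nonneg z₂.2, sq_nonneg z₃.1, sq_nonneg z₃.2])
  have k2 := key z₂ (by rw [hM]; nlinarith [sq_nonneg z₁.1, sq_nonneg z₁.2, sq_nonneg z₃.1, sq_nonneg z₃.2])
  have k3 := key z₃ (by rw [hM]; nlinarith [sq_nonneg z₂.1, sq_nonneg z₂.2, sq_nonneg z₁.1, sq_nonneg z₁.2])
  have k4 := Real.log_le_log hx hxR
  rw [← Real.log_le_iff_le_exp hR0, le_div_iff₀ (by linarith)]
  unfold Fun3 at hL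
  nlinarith [mul_le_mul_of_nonneg_left k1 ha.le, mul_le_mul_of_nonneg_left k2 hb.le,
    mul_le_mul_of_nonneg_left k3 hc.le, mul_le_mul_of_nonneg_left k4 hd.le]

theorem exists_min (a b c d : ℝ) (z₁ z₂ z₃ : ℝ × ℝ) (ha : 0 < a) (hb : 0 < b) (hc : 0 < c)
    (had : a < d) (hbd : b < d) (hcd : c < d) (hs : d < a + b + c)
    (h12 : z₁ ≠ z₂) (h13 : z₁ ≠ z₃) (h23 : z₂ ≠ z₃) :
    ∃ x : ℝ × ℝ × ℝ, 0 < x.2.2 ∧ ∀ y : ℝ × ℝ × ℝ, 0 < y.2.2 →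
      Fun3 a b c d z₁ z₂ z₃ x ≤ Fun3 a b c d z₁ z₂ z₃ y := by
  set F := Fun3 a b c d z₁ z₂ z₃ with hF
  obtain ⟨δ, hδ, h1⟩ := low_bound a b c d (F (0, 0, 1)) z₁ z₂ z₃ ha hb hc had hbd hcd h12 h13 h23
  obtain ⟨R, h2⟩ := up_bound a b c d (F (0, 0, 1)) z₁ z₂ z₃ ha hb hc (ha.trans had) hs
  set K : Set (ℝ × ℝ × ℝ) := {x | δ ≤ x.2.2 ∧ x.1 ^ 2 + x.2.1 ^ 2 + x.2.2 ≤ R} with hK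
  have hKc : IsCompact K := by
    have hsub : K ⊆ Set.Icc (-(R + 1)) (R + 1) ×ˢ Set.Icc (-(R + 1)) (R + 1) ×ˢ Set.Icc 0 R := by
      rintro ⟨u, v, s⟩ ⟨p, q⟩
      simp only at p q
      simp only [Set.mem_prod, Set.mem_Icc]
      refine ⟨⟨?_, ?_⟩, ⟨?_, ?_⟩, ?_, ?_⟩ <;>
        nlinarith [sq_nonneg (u + 1), sq_nonneg (u - 1), sq_nonneg (v + 1), sq_nonneg (v - 1),
          sq_nonneg u, sq_nonneg v]
    refine (isCompact_Icc.prod (isCompact_Icc.prod isCompact_Icc)).of_isClosed_subset ?_ hsub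
    have i1 : IsClosed {x : ℝ × ℝ × ℝ | δ ≤ x.2.2} := isClosed_le (by fun_prop) (by fun_prop)
    have i2 : IsClosed {x : ℝ × ℝ × ℝ | x.1 ^ 2 + x.2.1 ^ 2 + x.2.2 ≤ R} :=
      isClosed_le (by fun_prop) (by fun_prop)
    exact i1.inter i2
  have h0 : ((0, 0, 1) : ℝ × ℝ × ℝ) ∈ K :=
    ⟨h1 _ (by norm_num) le_rfl, h2 _ (by norm_num) le_rfl⟩
  have hcont : ContinuousOn F K := by
    intro x hx
    have hx0 : 0 < x.2.2 := hδ.trans_le hx.1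
    have n : ∀ z, hgt z x ≠ 0 := fun z => (hx0.trans_le (hgt_ge z x)).ne'
    have hc : ∀ z, Continuous (hgt z) := by intro z; unfold hgt; fun_prop
    apply ContinuousAt.continuousWithinAt
    rw [hF]
    unfold Fun3
    have l : ∀ z, ContinuousAt (fun x => Real.log (hgt z x)) x :=
      fun z => (hc z).continuousAt.log (n z)
    have l' : ContinuousAt (fun x : ℝ × ℝ × ℝ => Real.log x.2.2) x :=
      ContinuousAt.log (by fun_prop) hx0.ne'
    exact (((continuousAt_const.mul (l _)).add (continuousAt_const.mul (l _))).add
      (continuousAt_const.mul (l _))).sub (continuousAt_const.mul l')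
  obtain ⟨x, hx, hmin⟩ := hKc.exists_isMinOn ⟨_, h0⟩ hcont
  refine ⟨x, hδ.trans_le hx.1, fun y hy => ?_⟩
  by_cases hyL : F y ≤ F (0, 0, 1)
  · exact hmin ⟨h1 y hy hyL, h2 y hy hyL⟩
  · exact (hmin h0).trans (not_le.1 hyL).le

theorem exists_crit (a b c d : ℝ) (z₁ z₂ z₃ : ℝ × ℝ) (ha : 0 < a) (hb : 0 < b) (hc : 0 < c)
    (had : a < d) (hbd : b < d) (hcd : c < d) (hs : d < a + b + c)
    (h12 : z₁ ≠ z₂) (h13 : z₁ ≠ z₃) (h23 : z₂ ≠ z₃) :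
    ∃ x : ℝ × ℝ × ℝ, 0 < x.2.2 ∧
      a * (x.1 - z₁.1) / hgt z₁ x + b * (x.1 - z₂.1) / hgt z₂ x
        + c * (x.1 - z₃.1) / hgt z₃ x = 0 ∧
      a * (x.2.1 - z₁.2) / hgt z₁ x + b * (x.2.1 - z₂.2) / hgt z₂ x
        + c * (x.2.1 - z₃.2) / hgt z₃ x = 0 ∧
      a * x.2.2 / hgt z₁ x + b * x.2.2 / hgt z₂ x + c * x.2.2 / hgt z₃ x = d := by
  obtain ⟨⟨u, v, s⟩, hs0, hmin⟩ := exists_min a b c d z₁ z₂ z₃ ha hb hc had hbd hcd hs h12 h13 h23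
  have n : ∀ z, hgt z (u, v, s) ≠ 0 := fun z => (hs0.trans_le (hgt_ge z (u, v, s))).ne'
  refine ⟨(u, v, s), hs0, ?_, ?_, ?_⟩
  · have hl : IsLocalMin (fun t => Fun3 a b c d z₁ z₂ z₃ (t, v, s)) u :=
      Filter.Eventually.of_forall fun t => hmin _ hs0
    have hd : ∀ z, HasDerivAt (fun t => Real.log (hgt z (t, v, s)))
        ((2 * (u - z.1)) / hgt z (u, v, s)) u := by
      intro z
      refine HasDerivAt.log ?_ (n z)
      unfold hgt
      have := ((((hasDerivAt_id u).sub_const z.1).pow 2).add_const ((v - z.2) ^ 2)).add_const s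
      refine HasDerivAt.congr_deriv (f := fun t => _) this ?_
      simp
    have := hl.hasDerivAt_eq_zero (((((hd z₁).const_mul a).add ((hd z₂).const_mul b)).add
      ((hd z₃).const_mul c)).sub_const (d * Real.log s))
    simp only
    linear_combination this / 2
  · have hl : IsLocalMin (fun t => Fun3 a b c d z₁ z₂ z₃ (u, t, s)) v :=
      Filter.Eventually.of_forall fun t => hmin _ hs0
    have hd : ∀ z, HasDerivAt (fun t => Real.log (hgt z (u, t, s)))
        ((2 * (v - z.2)) / hgt z (u, v, s)) v := by
      intro z
      refine HasDerivAt.log ?_ (n z)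
      unfold hgt
      have := ((((hasDerivAt_id v).sub_const z.2).pow 2).const_add ((u - z.1) ^ 2)).add_const s
      refine HasDerivAt.congr_deriv (f := fun t => _) this ?_
      simp
    have := hl.hasDerivAt_eq_zero (((((hd z₁).const_mul a).add ((hd z₂).const_mul b)).add
      ((hd z₃).const_mul c)).sub_const (d * Real.log s))
    simp only
    linear_combination this / 2
  · simp only at hs0
    have hl : IsLocalMin (fun t => Fun3 a b c d z₁ z₂ z₃ (u, v, t)) s := by
      filter_upwards [lt_mem_nhds hs0] with t ht using hmin _ ht
    have hd : ∀ z, HasDerivAt (fun t => Real.log (hgt z (u, v, t)))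
        (1 / hgt z (u, v, s)) s := by
      intro z
      refine HasDerivAt.log ?_ (n z)
      unfold hgt
      exact (hasDerivAt_id s).const_add ((u - z.1) ^ 2 + (v - z.2) ^ 2)
    have := hl.hasDerivAt_eq_zero (((((hd z₁).const_mul a).add ((hd z₂).const_mul b)).add
      ((hd z₃).const_mul c)).sub ((Real.hasDerivAt_log hs0.ne').const_mul d))
    simp only
    have hsinv : s * s⁻¹ = 1 := mul_inv_cancel₀ hs0.ne'
    linear_combination s * this + d * hsinv

/-- the inner product attached to a point of upper half space -/
noncomputable def BB (w : ℂ) (s : ℝ) (x y : Fin 2 → ℂ) : ℂ :=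
  (starRingEnd ℂ) (x 1 - w * x 0) * (y 1 - w * y 0) + s * ((starRingEnd ℂ) (x 0) * y 0)

/-- orthogonal projection onto the line through `v` -/
noncomputable def PP (w : ℂ) (s : ℝ) (v : Fin 2 → ℂ) : (Fin 2 → ℂ) →ₗ[ℂ] (Fin 2 → ℂ) where
  toFun x := (BB w s v x / BB w s v v) • v
  map_add' x y := by
    rw [← add_smul, ← add_div]; congr 2; simp [BB]; ring
  map_smul' c x := by
    rw [RingHom.id_apply, smul_smul]; congr 1; simp [BB]; ring

theorem BB_symm (w : ℂ) (s : ℝ) (x y : Fin 2 → ℂ) :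
    BB w s x y = (starRingEnd ℂ) (BB w s y x) := by
  simp [BB]; ring

theorem BB_self (w : ℂ) (s : ℝ) (x : Fin 2 → ℂ) :
    BB w s x x = ((Complex.normSq (x 1 - w * x 0) + s * Complex.normSq (x 0) : ℝ) : ℂ) := by
  unfold BB
  push_cast
  rw [Complex.normSq_eq_conj_mul_self, Complex.normSq_eq_conj_mul_self]

theorem BB_pos (w : ℂ) (s : ℝ) (hs : 0 < s) (x : Fin 2 → ℂ) (hx : x ≠ 0) :
    0 < (BB w s x x).re := by
  rw [BB_self, Complex.ofReal_re]
  by_cases h : x 0 = 0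
  · have h1 : x 1 ≠ 0 := by
      intro h1; apply hx; ext i; fin_cases i <;> simp [h, h1]
    simpa [h] using h1
  · have := Complex.normSq_pos.2 h
    have := Complex.normSq_nonneg (x 1 - w * x 0)
    positivity

theorem BB_ne (w : ℂ) (s : ℝ) (hs : 0 < s) (x : Fin 2 → ℂ) (hx : x ≠ 0) :
    BB w s x x ≠ 0 := by
  intro h
  have := BB_pos w s hs x hx
  simp [h] at this

theorem PP_self (w : ℂ) (s : ℝ) (hs : 0 < s) (v : Fin 2 → ℂ) (hv : v ≠ 0) :
    PP w s v v = v := by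
  simp [PP, BB_ne w s hs v hv]

theorem PP_range (w : ℂ) (s : ℝ) (hs : 0 < s) (v : Fin 2 → ℂ) (hv : v ≠ 0) :
    LinearMap.range (PP w s v) = Submodule.span ℂ {v} := by
  apply le_antisymm
  · rintro _ ⟨x, rfl⟩
    exact Submodule.smul_mem _ _ (Submodule.mem_span_singleton_self v)
  · rw [Submodule.span_singleton_le_iff_mem]
    exact ⟨v, PP_self w s hs v hv⟩

theorem PP_idem (w : ℂ) (s : ℝ) (hs : 0 < s) (v : Fin 2 → ℂ) (hv : v ≠ 0) :
    PP w s v ∘ₗ PP w s v = PP w s v := by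
  refine LinearMap.ext fun t => ?_
  change PP w s v ((BB w s v t / BB w s v v) • v) = (BB w s v t / BB w s v v) • v
  rw [map_smul, PP_self w s hs v hv]

theorem PP_adj (w : ℂ) (s : ℝ) (v x y : Fin 2 → ℂ) :
    BB w s (PP w s v x) y = BB w s x (PP w s v y) := by
  have e1 : BB w s (PP w s v x) y
      = (starRingEnd ℂ) (BB w s v x / BB w s v v) * BB w s v y := by
    simp [PP, BB]; ring
  have e2 : BB w s x (PP w s v y) = (BB w s v y / BB w s v v) * BB w s x v := by
    simp [PP, BB]; ring
  rw [e1, e2, map_div₀, ← BB_symm, ← BB_symm]; ring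

/-- every nondegenerate quadruple S_μ (μ ≠ 0, 1) can be
unitarized with any character (a₀; a₁,a₂,a₃,a₄) satisfying aᵢ > 0,
2a₀ = Σaⱼ and 2aᵢ < Σaⱼ for each i. -/
theorem S_mu_unitarizable
    (μ : ℂ) (hμ0 : μ ≠ 0) (hμ1 : μ ≠ 1)
    (a₀ : ℝ) (a : Fin 4 → ℝ) (ha : ∀ i, 0 < a i)
    (hsum : 2 * a₀ = a 0 + a 1 + a 2 + a 3)
    (hlt : ∀ i, 2 * a i < a 0 + a 1 + a 2 + a 3) :
    Unitarizable
      (![Submodule.span ℂ {![(1 : ℂ), 0]},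
         Submodule.span ℂ {![(0 : ℂ), 1]},
         Submodule.span ℂ {![(1 : ℂ), μ]},
         Submodule.span ℂ {![(1 : ℂ), 1]}] : Fin 4 → Submodule ℂ (Fin 2 → ℂ)) a₀ a := by
  have hA : a 0 < a₀ ∧ a 2 < a₀ ∧ a 3 < a₀ ∧ a₀ < a 0 + a 2 + a 3 := by
    refine ⟨?_, ?_, ?_, ?_⟩ <;> linarith [hlt 0, hlt 1, hlt 2, hlt 3]
  obtain ⟨⟨u, v, s⟩, hs, c1, c2, c3⟩ := exists_crit (a 0) (a 2) (a 3) a₀ (0, 0) (μ.re, μ.im) (1, 0)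
    (ha 0) (ha 2) (ha 3) hA.1 hA.2.1 hA.2.2.1 hA.2.2.2
    (by intro h; apply hμ0; simp only [Prod.mk.injEq] at h; exact Complex.ext h.1.symm h.2.symm)
    (by simp)
    (by intro h; apply hμ1; simp only [Prod.mk.injEq] at h; exact Complex.ext h.1 h.2)
  simp only at hs c1 c2 c3
  set w : ℂ := ⟨u, v⟩ with hw
  have nv : ∀ z : ℂ, (![1, z] : Fin 2 → ℂ) ≠ 0 := by
    intro z h; simpa using congrFun h 0
  have nv' : (![0, 1] : Fin 2 → ℂ) ≠ 0 := by
    intro h; simpa using congrFun h 1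
  have hB : ∀ z : ℂ, BB w s ![1, z] ![1, z] = (hgt (z.re, z.im) (u, v, s) : ℝ) := by
    intro z
    rw [BB_self]
    congr 1
    simp [hgt, Complex.normSq_apply, hw]; ring
  refine ⟨BB w s, ![PP w s ![1, 0], PP w s ![0, 1], PP w s ![1, μ], PP w s ![1, 1]],
    ?_, ?_, BB_symm w s, BB_pos w s hs, ?_, ?_, ?_, ?_⟩
  · intro x y z; simp [BB]; ring
  · intro c x y; simp [BB]; ring
  · intro i
    fin_cases i
    · exact PP_range w s hs _ (nv 0)
    · exact PP_range w s hs _ nv'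
    · exact PP_range w s hs _ (nv μ)
    · exact PP_range w s hs _ (nv 1)
  · intro i
    fin_cases i
    · exact PP_idem w s hs _ (nv 0)
    · exact PP_idem w s hs _ nv'
    · exact PP_idem w s hs _ (nv μ)
    · exact PP_idem w s hs _ (nv 1)
  · intro i x y
    fin_cases i <;> exact PP_adj w s _ x y
  · have n : ∀ z, hgt z (u, v, s) ≠ 0 := fun z => (hs.trans_le (hgt_ge z (u, v, s))).ne'
    have H : ∀ z : ℂ, ((hgt (z.re, z.im) (u, v, s) : ℝ) : ℂ) ≠ 0 ∧
        ((hgt (z.re, z.im) (u, v, s) : ℝ) : ℂ) = (starRingEnd ℂ) (z - w) * (z - w) + s := by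
      intro z
      refine ⟨by exact_mod_cast n _, ?_⟩
      rw [← hB z]; simp [BB]
    obtain ⟨n0, q0⟩ := H 0
    obtain ⟨n2, q2⟩ := H μ
    obtain ⟨n3, q3⟩ := H 1
    have hB0 := hB 0
    have hB2 := hB μ
    have hB3 := hB 1
    simp only [Complex.zero_re, Complex.zero_im, Complex.one_re, Complex.one_im] at n0 q0 n3 q3 hB0 hB3
    generalize hgt (0, 0) (u, v, s) = f0 at *
    generalize hgt (μ.re, μ.im) (u, v, s) = f2 at *
    generalize hgt (1, 0) (u, v, s) = f3 at *
    have E1 : (a 0 : ℂ) * (starRingEnd ℂ) (0 - w) / f0 + a 2 * (starRingEnd ℂ) (μ - w) / f2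
        + a 3 * (starRingEnd ℂ) (1 - w) / f3 = 0 := by
      have hwc : (starRingEnd ℂ) w = u - v * Complex.I := by
        apply Complex.ext <;> simp [hw]
      have hmc : (starRingEnd ℂ) μ = μ.re - μ.im * Complex.I := by
        apply Complex.ext <;> simp
      have C1 := congrArg (fun t : ℝ => (t : ℂ)) c1
      have C2 := congrArg (fun t : ℝ => (t : ℂ)) c2
      push_cast at C1 C2
      rw [map_sub, map_sub, map_sub, hwc, hmc, map_zero, map_one]
      linear_combination -C1 + Complex.I * C2
    have E5 : (a 0 : ℂ) * (0 - w) / f0 + a 2 * (μ - w) / f2 + a 3 * (1 - w) / f3 = 0 := by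
      simpa using congrArg (starRingEnd ℂ) E1
    have E2 : (a 0 : ℂ) * s / f0 + a 2 * s / f2 + a 3 * s / f3 = a₀ := by
      exact_mod_cast c3
    have E3 : (2 : ℂ) * a₀ = a 0 + a 1 + a 2 + a 3 := by exact_mod_cast hsum
    refine LinearMap.ext fun x => ?_
    have hP : ∀ z : ℂ, ∀ f : ℝ, BB w s ![1, z] ![1, z] = f → PP w s ![1, z] x =
        (((starRingEnd ℂ) (z - w) * (x 1 - w * x 0) + s * x 0) / f) • ![1, z] := by
      intro z f hf
      change (BB w s ![1, z] x / BB w s ![1, z] ![1, z]) • ![1, z] = _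
      rw [hf]; simp [BB]
    have hP' : PP w s ![0, 1] x = (x 1 - w * x 0) • ![0, 1] := by
      change (BB w s ![0, 1] x / BB w s ![0, 1] ![0, 1]) • ![0, 1] = _
      simp [BB]
    have R0 : (f0 : ℂ) / f0 = 1 := div_self n0
    have R2 : (f2 : ℂ) / f2 = 1 := div_self n2
    have R3 : (f3 : ℂ) / f3 = 1 := div_self n3
    have E4 : (a 0 : ℂ) * ((starRingEnd ℂ) (0 - w) * (0 - w)) / f0
        + a 2 * ((starRingEnd ℂ) (μ - w) * (μ - w)) / f2
        + a 3 * ((starRingEnd ℂ) (1 - w) * (1 - w)) / f3 = a 0 + a 2 + a 3 - a₀ := by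
      linear_combination (a 0 : ℂ) * R0 + a 2 * R2 + a 3 * R3 - E2 - (a 0 : ℂ) / f0 * q0
        - (a 2 : ℂ) / f2 * q2 - (a 3 : ℂ) / f3 * q3
    simp only [Fin.sum_univ_four, LinearMap.add_apply, LinearMap.smul_apply, LinearMap.id_apply]
    simp only [Matrix.cons_val]
    rw [hP 0 _ hB0, hP μ _ hB2, hP 1 _ hB3, hP']
    generalize (starRingEnd ℂ) (0 - w) = k0 at *
    generalize (starRingEnd ℂ) (μ - w) = k2 at *
    generalize (starRingEnd ℂ) (1 - w) = k3 at *
    ext i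
    fin_cases i
    · simp
      linear_combination (x 1 - w * x 0) * E1 + x 0 * E2
    · simp
      linear_combination (x 1 - w * x 0) * E4 + w * (x 1 - w * x 0) * E1 + w * x 0 * E2
        + s * x 0 * E5 - (x 1 - w * x 0) * E3
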